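/- Let φ : R_A → R_B be a graded ring isomorphism that is k-stable, let ℓ > k+1 be the smallest integer with φ(x_{k+1}) ∈ F_ℓ(B), and set p := b_{ℓ,ℓ−1}. If p is even, then there exist a strictly lower-triangular integer matrix B' whose i-th row coincides with that of B for all i < ℓ−1, and a k-stable graded ring isomorphism g : R_B → R_{B'} that is a finite composition of switching and twisting isomorphisms, such that (g ∘ φ)(x_{k+1}) ∈ F_{ℓ−1}(B'). -/

import Mathlib

open MvPolynomial

namespace Bott

/-- A square integer matrix indexed by `Fin n` (rows, columns).  We think of it as the
matrix `A = (a_{ij})` defining a Bott tower; strict lower triangularity is the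
predicate `SLT` below. -/
abbrev Mat (n : ℕ) := Fin n → Fin n → ℤ

/-- `a` is strictly lower triangular: `a i j = 0` unless `j < i`. -/
def SLT {n : ℕ} (a : Mat n) : Prop := ∀ i j : Fin n, a i j ≠ 0 → (j : ℕ) < (i : ℕ)

section Defs

variable (n : ℕ)

/-- The linear form `α_i = ∑_{j<i} a_{ij} x_j` (the terms with `j ≥ i` vanish for a
strictly lower triangular matrix). -/
noncomputable def alpha (a : Mat n) (i : Fin n) : MvPolynomial (Fin n) ℤ :=
  ∑ j, C (a i j) * X j

/-- The ideal `(x_i² − α_i x_i : 1 ≤ i ≤ n)`. -/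
noncomputable def bottIdeal (a : Mat n) : Ideal (MvPolynomial (Fin n) ℤ) :=
  Ideal.span (Set.range fun i : Fin n => X i ^ 2 - alpha n a i * X i)

/-- The Bott ring `R_A = ℤ[x_1,…,x_n]/(x_i² − α_i x_i)`. -/
abbrev BRing (a : Mat n) := MvPolynomial (Fin n) ℤ ⧸ bottIdeal n a

/-- Quotient projection onto the Bott ring. -/
noncomputable def bmk (a : Mat n) : MvPolynomial (Fin n) ℤ →+* BRing n a :=
  Ideal.Quotient.mk _

/-- The class `x_i` in the Bott ring (0-based: `bx a i` is the paper's `x_{i+1}`). -/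
noncomputable def bx (a : Mat n) (i : Fin n) : BRing n a := bmk n a (X i)

/-- The class of `α_i` in the Bott ring. -/
noncomputable def bal (a : Mat n) (i : Fin n) : BRing n a := bmk n a (alpha n a i)

/-- `F_k(A)`: the span of the first `k` degree-2 generators (paper's `x_1, …, x_k`,
0-based indices `< k`). -/
noncomputable def F (a : Mat n) (k : ℕ) : Submodule ℤ (BRing n a) :=
  Submodule.span ℤ (bx n a '' {i : Fin n | (i : ℕ) < k})

/-- `H²(A)`: the span of all the degree-2 generators. -/
noncomputable def H2 (a : Mat n) : Submodule ℤ (BRing n a) :=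
  Submodule.span ℤ (Set.range (bx n a))

/-- `ht(η) = min {k | η ∈ F_k(A)}`. -/
noncomputable def ht (a : Mat n) (η : BRing n a) : ℕ := sInf {k | η ∈ F n a k}

/-- A ring isomorphism between Bott rings is graded iff it preserves the degree-2
components in both directions (both rings are generated in degree 2, so this is
equivalent to preserving the whole grading). -/
def IsGraded (a b : Mat n) (φ : BRing n a ≃+* BRing n b) : Prop :=
  (∀ z ∈ H2 n a, φ z ∈ H2 n b) ∧ (∀ z ∈ H2 n b, φ.symm z ∈ H2 n a)

/-- `φ` is `k`-stable: `φ(F_k(A)) ⊆ F_k(B)`. -/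
def IsStable (a b : Mat n) (k : ℕ) (φ : BRing n a ≃+* BRing n b) : Prop :=
  ∀ z ∈ F n a k, φ z ∈ F n b k

/-! ### Rationalizations -/

/-- The linear form `α_i` with rational coefficients. -/
noncomputable def alphaQ (a : Mat n) (i : Fin n) : MvPolynomial (Fin n) ℚ :=
  ∑ j, C ((a i j : ℚ)) * X j

noncomputable def bottIdealQ (a : Mat n) : Ideal (MvPolynomial (Fin n) ℚ) :=
  Ideal.span (Set.range fun i : Fin n => X i ^ 2 - alphaQ n a i * X i)

/-- The rationalized Bott ring `R_A ⊗ ℚ`. -/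
abbrev BRingQ (a : Mat n) := MvPolynomial (Fin n) ℚ ⧸ bottIdealQ n a

noncomputable def bmkQ (a : Mat n) : MvPolynomial (Fin n) ℚ →+* BRingQ n a :=
  Ideal.Quotient.mk _

noncomputable def bxQ (a : Mat n) (i : Fin n) : BRingQ n a := bmkQ n a (X i)

noncomputable def balQ (a : Mat n) (i : Fin n) : BRingQ n a := bmkQ n a (alphaQ n a i)

/-- `F_k(A) ⊗ ℚ` inside `R_A ⊗ ℚ`. -/
noncomputable def FQ (a : Mat n) (k : ℕ) : Submodule ℚ (BRingQ n a) :=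
  Submodule.span ℚ (bxQ n a '' {i : Fin n | (i : ℕ) < k})

/-- The canonical map `R_A → R_A ⊗ ℚ`. -/
noncomputable def toQ (a : Mat n) : BRing n a →+* BRingQ n a :=
  Ideal.Quotient.lift (bottIdeal n a)
    ((bmkQ n a).comp (MvPolynomial.map (Int.castRingHom ℚ)))
    (by
      intro p hp
      have hmap : ∀ i : Fin n,
          MvPolynomial.map (Int.castRingHom ℚ) (alpha n a i) = alphaQ n a i := by
        intro i
        simp [alpha, alphaQ, map_sum]
      have h : bottIdeal n a ≤
          Ideal.comap (MvPolynomial.map (Int.castRingHom ℚ)) (bottIdealQ n a) := by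
        rw [bottIdeal, Ideal.span_le]
        rintro _ ⟨i, rfl⟩
        simp only [SetLike.mem_coe, Ideal.mem_comap, map_sub, map_mul, map_pow,
          MvPolynomial.map_X, hmap]
        exact Ideal.subset_span ⟨i, rfl⟩
      rw [RingHom.comp_apply]
      exact Ideal.Quotient.eq_zero_iff_mem.mpr (h hp))

/-- The truncated linear form `β̄_ℓ` (rational version): for a 0-based row index `li`,
this is `∑_{k ≤ j < li} b_{li,j} y_j`, i.e. the paper's `β_ℓ` with its terms in
`F_k(B)` removed. -/
noncomputable def bbarQ (b : Mat n) (k : ℕ) (li : Fin n) : BRingQ n b :=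
  ∑ j ∈ Finset.univ.filter (fun j : Fin n => k ≤ (j : ℕ) ∧ j < li),
    (b li j : ℚ) • bxQ n b j

/-- Half of the truncated linear form `β̄_ℓ / 2` (meaningful when all relevant entries
are even), as an element of the integral Bott ring. -/
noncomputable def bbarHalf (b : Mat n) (k : ℕ) (li : Fin n) : BRing n b :=
  ∑ j ∈ Finset.univ.filter (fun j : Fin n => k ≤ (j : ℕ) ∧ j < li),
    (b li j / 2) • bx n b j

/-! ### Switching and twisting -/

/-- The matrix obtained from `b` by exchanging the rows and columns `p` and `q`. -/
def swapMat (b : Mat n) (p q : Fin n) : Mat n :=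
  fun i j => b (Equiv.swap p q i) (Equiv.swap p q j)

/-- `g : R_C → R_{C'}` is a switching isomorphism: for some `j` (0-based `J`) with
`c_{j+1,j} = 0`, `C'` is obtained from `C` by exchanging the `j`-th and `(j+1)`-st rows
and columns, and `g` swaps the `j`-th and `(j+1)`-st generators and fixes the others. -/
def IsSwitch (c c' : Mat n) (g : BRing n c ≃+* BRing n c') : Prop :=
  IsGraded n c c' g ∧
  ∃ (J : ℕ) (hJ : J + 1 < n),
    c ⟨J + 1, hJ⟩ ⟨J, by omega⟩ = 0 ∧
    c' = swapMat n c ⟨J, by omega⟩ ⟨J + 1, hJ⟩ ∧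
    ∀ i, g (bx n c i) = bx n c' (Equiv.swap (⟨J, by omega⟩ : Fin n) ⟨J + 1, hJ⟩ i)

/-- `g : R_C → R_{C'}` is a twisting isomorphism: for some `j` (0-based `J`) and
`v ∈ F_{j−1}(C)` with `v(γ_j − v) = 0`, the rows of `C'` before `j` agree with those of
`C`, `γ'_j = γ_j − 2v`, and `g` is a graded isomorphism fixing the first `j−1`
generators. -/
def IsTwist (c c' : Mat n) (g : BRing n c ≃+* BRing n c') : Prop :=
  IsGraded n c c' g ∧
  ∃ (J : ℕ) (hJ : J < n) (v : BRing n c),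
    v ∈ F n c J ∧ v * (bal n c ⟨J, hJ⟩ - v) = 0 ∧
    (∀ i : Fin n, (i : ℕ) < J → ∀ m, c' i m = c i m) ∧
    ((∑ m, c' ⟨J, hJ⟩ m • bx n c m) = bal n c ⟨J, hJ⟩ - 2 • v) ∧
    (∀ i : Fin n, (i : ℕ) < J → g (bx n c i) = bx n c' i)

/-- `IsMoveComp n c c' g` : `g : R_C → R_{C'}` is a finite (possibly empty) composition
of switching and twisting isomorphisms. -/
inductive IsMoveComp : ∀ c c' : Mat n, (BRing n c ≃+* BRing n c') → Prop
  | refl (c : Mat n) : IsMoveComp c c (RingEquiv.refl _)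
  | switch {c c' c'' : Mat n} {g : BRing n c ≃+* BRing n c'}
      {g' : BRing n c' ≃+* BRing n c''} :
      IsMoveComp c c' g → IsSwitch n c' c'' g' → IsMoveComp c c'' (g.trans g')
  | twist {c c' c'' : Mat n} {g : BRing n c ≃+* BRing n c'}
      {g' : BRing n c' ≃+* BRing n c''} :
      IsMoveComp c c' g → IsTwist n c' c'' g' → IsMoveComp c c'' (g.trans g')

end Defs

/-! ### Block matrices for ℚ-trivial Bott manifolds -/

/-- Starting (0-based) index of the `s`-th block for the partition `lam`. -/
def blockStart (t : ℕ) (lam : Fin t → ℕ) (s : Fin t) : ℕ :=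
  ∑ s' ∈ Finset.univ.filter (fun s' : Fin t => s' < s), lam s'

/-- The block-diagonal matrix with diagonal blocks `H_{λ_1}, …, H_{λ_t}`, where `H_j`
is the `j × j` strictly lower triangular matrix whose first column below the diagonal
consists of `1`s and whose other entries vanish. -/
def blockMat (n t : ℕ) (lam : Fin t → ℕ) : Mat n := fun i j =>
  if ∃ s : Fin t, (j : ℕ) = blockStart t lam s ∧ blockStart t lam s < (i : ℕ) ∧
      (i : ℕ) < blockStart t lam s + lam s then 1 else 0

/-- `H²(ℋ_{λ_s})`: the subgroup of the degree-2 component spanned by the generators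
belonging to the `s`-th block. -/
noncomputable def blockH2 (n t : ℕ) (lam : Fin t → ℕ) (s : Fin t) :
    Submodule ℤ (BRing n (blockMat n t lam)) :=
  Submodule.span ℤ (bx n (blockMat n t lam) ''
    {i : Fin n | blockStart t lam s ≤ (i : ℕ) ∧ (i : ℕ) < blockStart t lam s + lam s})

end Bott

namespace Bott


section Helpers

variable {n : ℕ}

lemma bmk_surj (b : Mat n) : Function.Surjective (bmk n b) := Ideal.Quotient.mk_surjective

lemma bmk_C_mul (b : Mat n) (z : ℤ) (p : MvPolynomial (Fin n) ℤ) :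
    bmk n b (C z * p) = z • bmk n b p := by
  rw [map_mul, zsmul_eq_mul]
  congr 1

lemma bal_eq (b : Mat n) (i : Fin n) : bal n b i = ∑ j, b i j • bx n b j := by
  simp only [bal, alpha, map_sum, bmk_C_mul, bx]

lemma bx_sq (b : Mat n) (i : Fin n) : bx n b i ^ 2 = bal n b i * bx n b i := by
  rw [bx, bal, ← map_pow, ← map_mul]
  exact (Ideal.Quotient.eq).2 (Ideal.subset_span ⟨i, rfl⟩)

/-- Universal property of the Bott ring. -/
lemma exists_lift (b : Mat n) {S : Type*} [CommRing S] (r : Fin n → S)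
    (hr : ∀ i, r i ^ 2 = (∑ j, b i j • r j) * r i) :
    ∃ f : BRing n b →+* S, ∀ i, f (bx n b i) = r i := by
  refine ⟨Ideal.Quotient.lift (bottIdeal n b) (eval₂Hom (Int.castRingHom S) r) ?_, ?_⟩
  · intro p hp
    have h : bottIdeal n b ≤ RingHom.ker (eval₂Hom (Int.castRingHom S) r) := by
      rw [bottIdeal, Ideal.span_le]
      rintro _ ⟨i, rfl⟩
      simp only [SetLike.mem_coe, RingHom.mem_ker, map_sub, map_mul, map_pow, alpha, map_sum,
        hr i, zsmul_eq_mul, eval₂Hom_C, eval₂Hom_X', eq_intCast, map_intCast, sub_self]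
    exact h hp
  · intro i
    change eval₂Hom (Int.castRingHom S) r (X i) = r i
    simp

lemma hom_ext' (b : Mat n) {S : Type*} [CommRing S] (f g : BRing n b →+* S)
    (h : ∀ i, f (bx n b i) = g (bx n b i)) : f = g := by
  apply Ideal.Quotient.ringHom_ext
  apply MvPolynomial.ringHom_ext
  · intro z
    simp
  · intro i
    exact h i

lemma map_span_mem (b : Mat n) {S : Type*} [CommRing S] (f : BRing n b →+* S)
    (s : Set (BRing n b)) (W : Submodule ℤ S) (h : ∀ x ∈ s, f x ∈ W) (z : BRing n b)
    (hz : z ∈ Submodule.span ℤ s) : f z ∈ W := by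
  induction hz using Submodule.span_induction with
  | mem x hx => exact h x hx
  | zero => rw [map_zero]; exact W.zero_mem
  | add x y _ _ hx hy => rw [map_add]; exact W.add_mem hx hy
  | smul a x _ hx => rw [map_zsmul]; exact W.smul_mem a hx

lemma exists_equiv (b b' : Mat n) (r : Fin n → BRing n b') (r' : Fin n → BRing n b)
    (hr : ∀ i, r i ^ 2 = (∑ j, b i j • r j) * r i)
    (hr' : ∀ i, r' i ^ 2 = (∑ j, b' i j • r' j) * r' i)
    (h1 : ∀ f : BRing n b →+* BRing n b', (∀ i, f (bx n b i) = r i) → ∀ i, f (r' i) = bx n b' i)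
    (h2 : ∀ f : BRing n b' →+* BRing n b, (∀ i, f (bx n b' i) = r' i) → ∀ i, f (r i) = bx n b i)
    (hH : ∀ i, r i ∈ H2 n b') (hH' : ∀ i, r' i ∈ H2 n b) :
    ∃ g : BRing n b ≃+* BRing n b', (∀ i, g (bx n b i) = r i) ∧ IsGraded n b b' g := by
  obtain ⟨f, hf⟩ := exists_lift b r hr
  obtain ⟨f', hf'⟩ := exists_lift b' r' hr'
  refine ⟨RingEquiv.ofRingHom f f' ?_ ?_, ?_, ?_, ?_⟩
  · apply hom_ext'
    intro i
    simp [hf', h1 f hf]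
  · apply hom_ext'
    intro i
    simp [hf, h2 f' hf']
  · intro i
    simpa using hf i
  · intro z hz
    exact map_span_mem b f (Set.range (bx n b)) (H2 n b')
      (by rintro _ ⟨i, rfl⟩; rw [hf]; exact hH i) z hz
  · intro z hz
    exact map_span_mem b' f' (Set.range (bx n b')) (H2 n b)
      (by rintro _ ⟨i, rfl⟩; rw [hf']; exact hH' i) z hz

lemma bx_mem_H2 (b : Mat n) (i : Fin n) : bx n b i ∈ H2 n b :=
  Submodule.subset_span ⟨i, rfl⟩

lemma bx_mem_F (b : Mat n) (k : ℕ) (i : Fin n) (h : (i : ℕ) < k) : bx n b i ∈ F n b k :=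
  Submodule.subset_span ⟨i, h, rfl⟩

lemma mem_F_iff (b : Mat n) (k : ℕ) (z : BRing n b) :
    z ∈ F n b k ↔ ∃ c : Fin n → ℤ, (∀ i : Fin n, k ≤ (i : ℕ) → c i = 0) ∧
      z = ∑ i, c i • bx n b i := by
  constructor
  · intro hz
    rw [F] at hz
    induction hz using Submodule.span_induction with
    | mem x hx =>
      obtain ⟨i, hi, rfl⟩ := hx
      refine ⟨Pi.single i 1, ?_, ?_⟩
      · intro j hj
        have : j ≠ i := by
          rintro rfl
          simp at hi; omega
        simp [this]
      · simp [Pi.single_apply]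
    | zero => exact ⟨0, by simp, by simp⟩
    | add x y _ _ hx hy =>
      obtain ⟨c, hc, rfl⟩ := hx
      obtain ⟨d, hd, rfl⟩ := hy
      refine ⟨c + d, ?_, ?_⟩
      · intro i hi
        simp [hc i hi, hd i hi]
      · simp [add_smul, Finset.sum_add_distrib]
    | smul a x _ hx =>
      obtain ⟨c, hc, rfl⟩ := hx
      refine ⟨a • c, ?_, ?_⟩
      · intro i hi
        simp [hc i hi]
      · rw [Finset.smul_sum]
        exact Finset.sum_congr rfl fun i _ => by simp [mul_smul]
  · rintro ⟨c, hc, rfl⟩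
    refine Submodule.sum_mem _ fun i _ => ?_
    by_cases h : (i : ℕ) < k
    · exact Submodule.smul_mem _ _ (bx_mem_F b k i h)
    · rw [hc i (by omega)]; simp

/-- The linear form with coefficients `c`. -/
noncomputable def lin (c : Fin n → ℤ) : MvPolynomial (Fin n) ℤ := ∑ i, C (c i) * X i

lemma bmk_lin (b : Mat n) (c : Fin n → ℤ) : bmk n b (lin c) = ∑ i, c i • bx n b i := by
  simp only [lin, map_sum, bmk_C_mul, bx]

lemma lin_homog (c : Fin n → ℤ) : (lin c).IsHomogeneous 1 := by
  refine IsHomogeneous.sum _ _ _ fun i _ => ?_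
  simpa using (isHomogeneous_C (Fin n) (c i)).mul (isHomogeneous_X ℤ i)

lemma coeff_lin (c : Fin n → ℤ) (s : Fin n) : coeff (Finsupp.single s 1) (lin c) = c s := by
  classical
  rw [lin, coeff_sum, Finset.sum_eq_single s]
  · rw [coeff_C_mul, coeff_X, if_pos rfl, mul_one]
  · intro i _ hi
    rw [coeff_C_mul, coeff_X, if_neg, mul_zero]
    intro h
    exact hi ((Finsupp.single_left_inj one_ne_zero).1 h)
  · simp

lemma coeff_lin_mul_X (c : Fin n → ℤ) (s t j : Fin n) (hst : s ≠ t) :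
    coeff (Finsupp.single s 1 + Finsupp.single t 1) (lin c * X j) =
      (if j = t then c s else 0) + (if j = s then c t else 0) := by
  classical
  by_cases h1 : j = t
  · subst h1
    rw [coeff_mul_X, coeff_lin]; simp [hst.symm]
  · by_cases h2 : j = s
    · subst h2
      rw [add_comm, coeff_mul_X, coeff_lin]; simp [hst]
    · rw [coeff_mul_X', if_neg]
      · simp [h1, h2]
      · simp [Ne.symm h1, Ne.symm h2]

lemma coeff_lin_mul_X_same (c : Fin n → ℤ) (t j : Fin n) :
    coeff (Finsupp.single t 1 + Finsupp.single t 1) (lin c * X j) =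
      (if j = t then c t else 0) := by
  classical
  by_cases h1 : j = t
  · subst h1
    rw [coeff_mul_X, coeff_lin]; simp
  · rw [coeff_mul_X', if_neg]
    · simp [h1]
    · simp [Ne.symm h1]

/-- The coefficient of `y_s y_t` in the normal form of a quadratic polynomial. -/
noncomputable def Lf (b : Mat n) (s t : Fin n) (P : MvPolynomial (Fin n) ℤ) : ℤ :=
  coeff (Finsupp.single s 1 + Finsupp.single t 1) P +
    b t s * coeff (Finsupp.single t 1 + Finsupp.single t 1) P

lemma Lf_add (b : Mat n) (s t : Fin n) (P Q : MvPolynomial (Fin n) ℤ) :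
    Lf b s t (P + Q) = Lf b s t P + Lf b s t Q := by
  simp [Lf]; ring

lemma Lf_lin_mul_lin (b : Mat n) (s t : Fin n) (hst : s ≠ t) (c d : Fin n → ℤ) :
    Lf b s t (lin c * lin d) = c s * d t + c t * d s + b t s * (c t * d t) := by
  have : lin c * lin d = ∑ j, C (d j) * (lin c * X j) := by
    rw [lin, lin, Finset.mul_sum]
    exact Finset.sum_congr rfl fun j _ => by ring
  rw [Lf, this, coeff_sum, coeff_sum]
  simp only [coeff_C_mul, coeff_lin_mul_X c s t _ hst, coeff_lin_mul_X_same]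
  simp [mul_add, Finset.sum_add_distrib]
  ring

lemma coeff_mul_homog (f Q : MvPolynomial (Fin n) ℤ) (hQ : Q.IsHomogeneous 2)
    (u v : Fin n) :
    coeff (Finsupp.single u 1 + Finsupp.single v 1) (f * Q) =
      coeff 0 f * coeff (Finsupp.single u 1 + Finsupp.single v 1) Q := by
  classical
  rw [coeff_mul, Finset.sum_eq_single (0, Finsupp.single u 1 + Finsupp.single v 1)]
  · rintro ⟨x, y⟩ hxy hne
    rw [Finset.HasAntidiagonal.mem_antidiagonal] at hxy
    simp only at hxy ⊢
    by_contra hcon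
    have hy : coeff y Q ≠ 0 := right_ne_zero_of_mul hcon
    have hdeg : y.degree = 2 := by
      by_contra h
      exact hy (hQ.coeff_eq_zero h)
    have h2 := congrArg Finsupp.degree hxy
    simp [map_add, hdeg] at h2
    have hx : x = 0 := (Finsupp.degree_eq_zero_iff x).1 h2
    subst hx
    apply hne
    simpa using hxy
  · intro h
    exact absurd (by simp) h

/-- The generators of the ideal as products of linear forms. -/
lemma gen_eq (b : Mat n) (i : Fin n) :
    X i ^ 2 - alpha n b i * X i = lin (Pi.single i 1 - b i) * lin (Pi.single i 1) := by
  have hX : (X i : MvPolynomial (Fin n) ℤ) = lin (Pi.single i 1) := by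
    simp [lin, Pi.single_apply]
  have : lin (Pi.single i 1 - b i) = X i - alpha n b i := by
    rw [hX]; simp [lin, alpha, sub_mul]
  rw [this, ← hX]; ring

lemma Lf_gen (b : Mat n) (hb : SLT b) (s t : Fin n) (hst : s < t) (i : Fin n) :
    Lf b s t (X i ^ 2 - alpha n b i * X i) = 0 := by
  rw [gen_eq, Lf_lin_mul_lin b s t hst.ne]
  have z1 : b s t = 0 := by
    by_contra h
    have := hb _ _ h
    omega
  have z2 : b t t = 0 := by
    by_contra h
    have := hb _ _ h
    omega
  by_cases h1 : i = t
  · subst h1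
    simp [hst.ne, z2]
  · by_cases h2 : i = s
    · subst h2
      simp [hst.ne', z1]
    · simp [Ne.symm h1, Ne.symm h2]

lemma Lf_ideal (b : Mat n) (hb : SLT b) (s t : Fin n) (hst : s < t)
    (P : MvPolynomial (Fin n) ℤ) (hP : P ∈ bottIdeal n b) :
    ∀ f : MvPolynomial (Fin n) ℤ, Lf b s t (f * P) = 0 := by
  rw [bottIdeal] at hP
  induction hP using Submodule.span_induction with
  | mem x hx =>
    obtain ⟨i, rfl⟩ := hx
    intro f
    have hh : (X i ^ 2 - alpha n b i * X i).IsHomogeneous 2 := by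
      rw [gen_eq]
      exact (lin_homog _).mul (lin_homog _)
    have h0 := Lf_gen b hb s t hst i
    rw [Lf] at h0 ⊢
    rw [coeff_mul_homog _ _ hh, coeff_mul_homog _ _ hh]
    linear_combination (coeff 0 f) * h0
  | zero => intro f; simp [Lf]
  | add x y _ _ hx hy => intro f; rw [mul_add, Lf_add, hx, hy, add_zero]
  | smul g x _ h =>
    intro f
    rw [smul_eq_mul, ← mul_assoc]
    exact h _

/-- If a product of two linear forms vanishes in the Bott ring, then the coefficients of its
normal form vanish. -/
lemma coeff_rel (b : Mat n) (hb : SLT b) (c d : Fin n → ℤ)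
    (h : (∑ i, c i • bx n b i) * (∑ i, d i • bx n b i) = 0) (s t : Fin n) (hst : s < t) :
    c s * d t + c t * d s + b t s * (c t * d t) = 0 := by
  rw [← bmk_lin, ← bmk_lin, ← map_mul] at h
  have := Lf_ideal b hb s t hst _ (Ideal.Quotient.eq_zero_iff_mem.1 h) 1
  rwa [one_mul, Lf_lin_mul_lin b s t hst.ne] at this

lemma sum_single_add (b : Mat n) (u : Fin n → ℤ) (v : Fin n → BRing n b) (M : Fin n) (q : ℤ) :
    ∑ j, (u j + if j = M then q else 0) • v j = ∑ j, u j • v j + q • v M := by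
  simp [add_smul, Finset.sum_add_distrib]

/-- The matrix of the twist by `q y_M` in row `T`. -/
def twMat (b : Mat n) (M T : Fin n) (q : ℤ) : Mat n :=
  fun i j => b i j + if j = M then (q * b i T - if i = T then 2 * q else 0) else 0

/-- The images of the generators under the twist by `q y_M` in row `T`. -/
noncomputable def twGen (b : Mat n) (M T : Fin n) (q : ℤ) (i : Fin n) : BRing n b :=
  bx n b i + if i = T then q • bx n b M else 0

lemma twMat_SLT (b : Mat n) (hb : SLT b) (M T : Fin n) (hMT : M < T) (q : ℤ) :
    SLT (twMat b M T q) := by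
  intro i j h
  by_contra hij
  apply h
  have h1 : b i j = 0 := by
    by_contra h; exact hij (hb _ _ h)
  have h2 : j = M → b i T = 0 := by
    rintro rfl
    by_contra h
    have := hb _ _ h
    omega
  have h3 : j = M → i ≠ T := by
    rintro rfl rfl
    omega
  by_cases hj : j = M
  · simp [twMat, h1, h2 hj, h3 hj]
  · simp [twMat, h1, hj]

/-- The relations satisfied by the twisted generators. -/
lemma tw_rel (b : Mat n) (hb : SLT b) (M T : Fin n) (hMT : M < T) (q : ℤ)
    (hv : (q • bx n b M) * (bal n b T - q • bx n b M) = 0) (i : Fin n) :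
    twGen b M T (-q) i ^ 2 =
      (∑ j, twMat b M T q i j • twGen b M T (-q) j) * twGen b M T (-q) i := by
  have hbT : b T T = 0 := by
    by_contra h
    have := hb _ _ h
    omega
  have e : ∑ j, twMat b M T q i j • twGen b M T (-q) j =
      bal n b i - if i = T then (2 * q) • bx n b M else 0 := by
    have e1 : ∑ j, b i j • twGen b M T (-q) j = bal n b i - (q * b i T) • bx n b M := by
      simp only [twGen, smul_add, Finset.sum_add_distrib, ← bal_eq]
      simp [sub_eq_add_neg]
      ring
    simp only [twMat]
    rw [sum_single_add, e1]
    have e2 : twGen b M T (-q) M = bx n b M := by simp [twGen, hMT.ne]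
    rw [e2]
    by_cases h : i = T
    · simp [h, sub_smul, hbT, sub_eq_add_neg]
    · simp [h]
  rw [e]
  by_cases h : i = T
  · subst h
    have hs := bx_sq b i
    simp only [twGen, if_true, neg_smul, mul_smul, two_smul]
    generalize q • bx n b M = v at *
    linear_combination hs + hv
  · simp [twGen, h, bx_sq]

lemma twMat_inv (b : Mat n) (hb : SLT b) (M T : Fin n) (hMT : M < T) (q : ℤ) :
    twMat (twMat b M T q) M T (-q) = b := by
  funext i j
  have hbT : b T T = 0 := by
    by_contra h
    have := hb _ _ h
    omega
  by_cases hj : j = M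
  · by_cases hi : i = T
    · simp [twMat, hj, hi, hMT.ne', hbT]
    · simp [twMat, hj, hi, hMT.ne']
  · simp [twMat, hj]

/-- Existence of the twist. -/
lemma exists_twist (b : Mat n) (hb : SLT b) (M T : Fin n) (hMT : M < T) (q : ℤ)
    (hv : (q • bx n b M) * (bal n b T - q • bx n b M) = 0)
    (hv' : (q • bx n (twMat b M T q) M) *
      (bal n (twMat b M T q) T + q • bx n (twMat b M T q) M) = 0) :
    ∃ g : BRing n b ≃+* BRing n (twMat b M T q),
      (∀ i, g (bx n b i) = twGen (twMat b M T q) M T q i) ∧ IsGraded n b (twMat b M T q) g := by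
  have hb' := twMat_SLT b hb M T hMT q
  refine exists_equiv b (twMat b M T q) (twGen (twMat b M T q) M T q) (twGen b M T (-q))
    ?_ (tw_rel b hb M T hMT q hv) ?_ ?_ ?_ ?_
  · intro i
    have := tw_rel (twMat b M T q) hb' M T hMT (-q) (by
      rw [neg_smul]; linear_combination -hv') i
    rwa [neg_neg, twMat_inv b hb M T hMT q] at this
  · intro f hf i
    by_cases h : i = T
    · simp [twGen, h, map_add, map_neg, map_zsmul, hf, hMT.ne]
    · simp [twGen, h, hf]
  · intro f hf i
    by_cases h : i = T
    · simp [twGen, h, map_add, map_neg, map_zsmul, hf, hMT.ne]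
    · simp [twGen, h, hf]
  · intro i
    refine Submodule.add_mem _ (bx_mem_H2 _ _) ?_
    split_ifs
    · exact Submodule.smul_mem _ _ (bx_mem_H2 _ _)
    · exact Submodule.zero_mem _
  · intro i
    refine Submodule.add_mem _ (bx_mem_H2 _ _) ?_
    split_ifs
    · exact Submodule.smul_mem _ _ (bx_mem_H2 _ _)
    · exact Submodule.zero_mem _

lemma swap_rel (b : Mat n) (M T i : Fin n) :
    bx n (swapMat n b M T) (Equiv.swap M T i) ^ 2 =
      (∑ j, b i j • bx n (swapMat n b M T) (Equiv.swap M T j)) *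
        bx n (swapMat n b M T) (Equiv.swap M T i) := by
  rw [bx_sq, bal_eq]
  congr 1
  rw [← Equiv.sum_comp (Equiv.swap M T)]
  simp [swapMat]

/-- Existence of the switch. -/
lemma exists_switch (b : Mat n) (M T : Fin n) :
    ∃ g : BRing n b ≃+* BRing n (swapMat n b M T),
      (∀ i, g (bx n b i) = bx n (swapMat n b M T) (Equiv.swap M T i)) ∧
        IsGraded n b (swapMat n b M T) g := by
  refine exists_equiv b (swapMat n b M T) _ (fun i => bx n b (Equiv.swap M T i))
    (swap_rel b M T) ?_ ?_ ?_ (fun i => bx_mem_H2 _ _) (fun i => bx_mem_H2 _ _)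
  · intro i
    rw [bx_sq, bal_eq]
    congr 1
    rw [← Equiv.sum_comp (Equiv.swap M T)]
    simp [swapMat]
  · intro f hf i
    simp [hf]
  · intro f hf i
    simp [hf]

/-- The product relation needed for the twist, from the coefficient relation. -/
lemma tw_cond (b : Mat n) (M T : Fin n) (q r : ℤ)
    (h : ∀ s, q * (b T s - (if s = M then r else 0) + (r - q) * b M s) = 0) :
    (q • bx n b M) * (bal n b T - q • bx n b M) = 0 := by
  have h1 : q • bal n b T - (q * r) • bx n b M + (q * (r - q)) • bal n b M = 0 := by
    have : ∑ s, (q * (b T s - (if s = M then r else 0) + (r - q) * b M s)) • bx n b s = 0 := by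
      simp [h]
    have e : ∀ s, (q * (b T s - (if s = M then r else 0) + (r - q) * b M s)) • bx n b s =
        q • (b T s • bx n b s) - (if s = M then (q * r) • bx n b s else 0) +
          (q * (r - q)) • (b M s • bx n b s) := by
      intro s
      split_ifs <;> module
    rw [← this, bal_eq, bal_eq, Finset.sum_congr rfl (fun s _ => e s), Finset.sum_add_distrib,
      Finset.sum_sub_distrib, Finset.smul_sum, Finset.smul_sum]
    simp
  have hs := bx_sq b M
  simp only [zsmul_eq_mul] at h1 ⊢
  push_cast at h1 ⊢
  linear_combination bx n b M * h1 + (q : BRing n b) * (r - q) * hs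

lemma graded_trans (a b c : Mat n) (g : BRing n a ≃+* BRing n b) (h : BRing n b ≃+* BRing n c)
    (hg : IsGraded n a b g) (hh : IsGraded n b c h) : IsGraded n a c (g.trans h) := by
  constructor
  · intro z hz
    rw [RingEquiv.trans_apply]
    exact hh.1 _ (hg.1 _ hz)
  · intro z hz
    rw [RingEquiv.symm_trans_apply]
    exact hg.2 _ (hh.2 _ hz)

end Helpers

set_option maxHeartbeats 1000000 in
/-- **Key lemma, even case.** Let `φ : R_A → R_B` be a `k`-stable
graded ring isomorphism, `ℓ > k + 1` the smallest integer with `φ(x_{k+1}) ∈ F_ℓ(B)`,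
and `p := b_{ℓ,ℓ−1}` even.  Then there are a strictly lower triangular matrix `B'`
whose `i`-th row agrees with that of `B` for `i < ℓ − 1` (0-based `i < ℓ − 2`), and a
`k`-stable graded ring isomorphism `g : R_B → R_{B'}`, a finite composition of
switching and twisting isomorphisms, with `(g ∘ φ)(x_{k+1}) ∈ F_{ℓ−1}(B')`. -/
theorem stmt_14 (n k : ℕ) (hk : k < n) (a b : Mat n) (ha : SLT a) (hb : SLT b)
    (φ : BRing n a ≃+* BRing n b) (hφ : IsGraded n a b φ) (hst : IsStable n a b k φ)
    (l : ℕ) (hlk : k + 1 < l) (hln : l ≤ n)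
    (hmem : φ (bx n a ⟨k, hk⟩) ∈ F n b l)
    (hmin : ∀ m < l, φ (bx n a ⟨k, hk⟩) ∉ F n b m)
    (hp : Even (b ⟨l - 1, by omega⟩ ⟨l - 2, by omega⟩)) :
    ∃ (b' : Mat n) (g : BRing n b ≃+* BRing n b'),
      SLT b' ∧ IsMoveComp n b b' g ∧ IsGraded n b b' g ∧ IsStable n b b' k g ∧
      (∀ i : Fin n, (i : ℕ) < l - 2 → ∀ m, b' i m = b i m) ∧
      g (φ (bx n a ⟨k, hk⟩)) ∈ F n b' (l - 1) := by
  obtain ⟨c, hc, hηc⟩ := (mem_F_iff b l _).1 hmem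
  have hT : l - 1 < n := by omega
  have hM : l - 2 < n := by omega
  obtain ⟨T, hTdef⟩ : ∃ T : Fin n, T = ⟨l - 1, hT⟩ := ⟨_, rfl⟩
  obtain ⟨M, hMdef⟩ : ∃ M : Fin n, M = ⟨l - 2, hM⟩ := ⟨_, rfl⟩
  have hTv : (T : ℕ) = l - 1 := by rw [hTdef]
  have hMv : (M : ℕ) = l - 2 := by rw [hMdef]
  have hMT : M < T := by rw [Fin.lt_def]; omega
  rw [← hTdef, ← hMdef] at hp
  obtain ⟨q, hq⟩ := hp
  -- the top coefficient is nonzero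
  have hcT : c T ≠ 0 := by
    intro h0
    refine hmin (l - 1) (by omega) ((mem_F_iff b _ _).2 ⟨c, ?_, hηc⟩)
    intro i hi
    by_cases hiT : i = T
    · rw [hiT, h0]
    · refine hc i ?_
      have : (i : ℕ) ≠ T := fun h => hiT (Fin.ext h)
      omega
  -- the image of the linear form
  have hw : φ (bal n a ⟨k, hk⟩) ∈ F n b k := by
    apply hst
    rw [mem_F_iff]
    refine ⟨a ⟨k, hk⟩, ?_, bal_eq a _⟩
    intro i hi
    by_contra h
    have := ha _ _ h
    simp at this
    omega
  obtain ⟨w, hwk, hw⟩ := (mem_F_iff b k _).1 hw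
  have hprod : (∑ i, c i • bx n b i) * (∑ i, (c - w) i • bx n b i) = 0 := by
    have e : ∑ i, (c - w) i • bx n b i = φ (bx n a ⟨k, hk⟩) - φ (bal n a ⟨k, hk⟩) := by
      rw [hηc, hw]
      simp [sub_smul]
    rw [e, ← hηc, ← map_sub, ← map_mul]
    have := bx_sq a ⟨k, hk⟩
    rw [show bx n a ⟨k, hk⟩ * (bx n a ⟨k, hk⟩ - bal n a ⟨k, hk⟩) = 0 by
      linear_combination this, map_zero]
  have hrel := coeff_rel b hb c (c - w) hprod
  have hwT : w T = 0 := hwk T (by omega)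
  have hwM : w M = 0 := hwk M (by omega)
  have rT : ∀ s, s < T → c s + (c s - w s) + b T s * c T = 0 := by
    intro s hs
    have := hrel s T hs
    simp only [Pi.sub_apply, hwT, sub_zero] at this
    apply mul_left_cancel₀ hcT
    linear_combination this
  have hcM : c M = - (c T * q) := by
    have := rT M hMT
    rw [hwM, hq] at this
    linarith
  have hzero : ∀ i j : Fin n, i ≤ j → b i j = 0 := by
    intro i j hij
    by_contra h
    have := hb _ _ h
    rw [Fin.le_def] at hij
    omega
  have hlow : ∀ s, s < M → q * (b T s + q * b M s) = 0 := by
    intro s hs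
    have h1 := hrel s M hs
    have h2 := rT s (hs.trans hMT)
    simp only [Pi.sub_apply, hwM, sub_zero, hcM] at h1
    apply mul_left_cancel₀ (mul_ne_zero hcT hcT)
    linear_combination h1 + c T * q * h2
  have hcoef : ∀ s, q * (b T s - (if s = M then 2 * q else 0) + q * b M s) = 0 := by
    intro s
    rcases lt_trichotomy s M with h | h | h
    · simpa [h.ne] using hlow s h
    · subst h
      rw [hq, hzero s s le_rfl]
      simp; right; ring
    · have h' : T ≤ s := by
        rw [Fin.le_def]; rw [Fin.lt_def] at h; omega
      simp [h.ne', hzero T s h', hzero M s h.le]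
  have hv := tw_cond b M T q (2 * q) (by
    intro s
    have := hcoef s
    linear_combination this)
  set b' := twMat b M T q with hb'def
  have hb' : SLT b' := twMat_SLT b hb M T hMT q
  have hb'TM : b' T M = 0 := by
    simp [hb'def, twMat, hq, hzero T T le_rfl]; ring
  have hb'T : ∀ s, b' T s = b T s - if s = M then 2 * q else 0 := by
    intro s
    by_cases hs : s = M
    · simp [hb'def, twMat, hs, hzero T T le_rfl, sub_eq_add_neg]
    · simp [hb'def, twMat, hs]
  have hb'lt : ∀ i, i < T → ∀ m, b' i m = b i m := by
    intro i hi m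
    simp [hb'def, twMat, hzero i T hi.le, hi.ne]
  have hv' : (q • bx n b' M) * (bal n b' T + q • bx n b' M) = 0 := by
    have := tw_cond b' M T (-q) 0 (by
      intro s
      have h1 := hcoef s
      rw [hb'T, hb'lt M hMT]
      simp only [ite_self]
      linear_combination -h1)
    rw [neg_smul] at this
    linear_combination -this
  obtain ⟨g₁, hg₁, hgr₁⟩ : ∃ g : BRing n b ≃+* BRing n b',
      (∀ i, g (bx n b i) = twGen b' M T q i) ∧ IsGraded n b b' g :=
    exists_twist b hb M T hMT q hv hv'
  clear_value b'
  obtain ⟨g₂, hg₂, hgr₂⟩ := exists_switch b' M T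
  have htw : IsTwist n b b' g₁ := by
    refine ⟨hgr₁, l - 1, hT, q • bx n b M, ?_, ?_, ?_, ?_, ?_⟩
    · exact Submodule.smul_mem _ _ (bx_mem_F b _ M (by omega))
    · rw [← hTdef]; exact hv
    · intro i hi m
      exact hb'lt i (by rw [Fin.lt_def]; omega) m
    · rw [← hTdef, bal_eq]
      simp only [hb'T, sub_smul, Finset.sum_sub_distrib]
      simp [mul_assoc]
    · intro i hi
      rw [hg₁]
      have : i ≠ T := by rintro rfl; omega
      simp [twGen, this]
  have hsw : IsSwitch n b' (swapMat n b' M T) g₂ := by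
    have hTM : (⟨l - 2 + 1, by omega⟩ : Fin n) = T := by
      apply Fin.ext; simp only [hTv]; omega
    refine ⟨hgr₂, l - 2, by omega, ?_, ?_, ?_⟩
    · rw [hTM, ← hMdef]; exact hb'TM
    · rw [hTM, ← hMdef]
    · rw [hTM, ← hMdef]; exact hg₂
  have hsmall : ∀ i : Fin n, (i : ℕ) < l - 2 →
      g₂ (g₁ (bx n b i)) = bx n (swapMat n b' M T) i := by
    intro i hi
    have h1 : i ≠ T := by rintro rfl; omega
    have h2 : i ≠ M := by rintro rfl; omega
    rw [hg₁, twGen, if_neg h1, add_zero, hg₂, Equiv.swap_apply_of_ne_of_ne h2 h1]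
  refine ⟨swapMat n b' M T, g₁.trans g₂, ?_, ?_, ?_, ?_, ?_, ?_⟩
  · intro i j hij
    have h := hb' _ _ hij
    rw [swapMat] at hij
    by_contra hcon
    by_cases i1 : i = M
    · by_cases j1 : j = M
      · subst i1 j1; simp at h
      · by_cases j2 : j = T
        · subst i1 j2; simp [hb'TM] at hij
        · subst i1
          rw [Equiv.swap_apply_left, Equiv.swap_apply_of_ne_of_ne j1 j2] at h
          have : (j : ℕ) ≠ i := fun h => j1 (Fin.ext h)
          omega
    · by_cases i2 : i = T
      · by_cases j1 : j = M
        · subst i2 j1; omega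
        · by_cases j2 : j = T
          · subst i2 j2; simp at h
          · subst i2
            rw [Equiv.swap_apply_right, Equiv.swap_apply_of_ne_of_ne j1 j2] at h
            omega
      · rw [Equiv.swap_apply_of_ne_of_ne i1 i2] at h
        have n1 : (i : ℕ) ≠ M := fun h => i1 (Fin.ext h)
        have n2 : (i : ℕ) ≠ T := fun h => i2 (Fin.ext h)
        by_cases j1 : j = M
        · subst j1
          rw [Equiv.swap_apply_left] at h
          omega
        · by_cases j2 : j = T
          · subst j2
            rw [Equiv.swap_apply_right] at h
            omega
          · rw [Equiv.swap_apply_of_ne_of_ne j1 j2] at h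
            omega
  · have h1 := IsMoveComp.twist (IsMoveComp.refl b) htw
    have h2 := IsMoveComp.switch h1 hsw
    exact h2
  · exact graded_trans _ _ _ g₁ g₂ hgr₁ hgr₂
  · intro z hz
    refine map_span_mem b (g₁.trans g₂ : BRing n b →+* BRing n (swapMat n b' M T)) _
      (F n (swapMat n b' M T) k) ?_ z hz
    rintro _ ⟨i, hi, rfl⟩
    have hi' : (i : ℕ) < k := hi
    rw [RingEquiv.coe_toRingHom, RingEquiv.trans_apply]
    rw [hsmall i (by omega)]
    exact bx_mem_F _ _ _ hi'
  · intro i hi m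
    have h1 : i ≠ T := by rintro rfl; omega
    have h2 : i ≠ M := by rintro rfl; omega
    have hiM : i < M := by rw [Fin.lt_def]; omega
    rw [swapMat, Equiv.swap_apply_of_ne_of_ne h2 h1, hb'lt i (hiM.trans hMT)]
    by_cases m1 : m = M
    · subst m1
      rw [Equiv.swap_apply_left, hzero i T (hiM.trans hMT).le, hzero i m hiM.le]
    · by_cases m2 : m = T
      · subst m2
        rw [Equiv.swap_apply_right, hzero i M hiM.le, hzero i m (hiM.trans hMT).le]
      · rw [Equiv.swap_apply_of_ne_of_ne m1 m2]
  · -- membership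
    have key : g₂ (g₁ (φ (bx n a ⟨k, hk⟩))) =
        ∑ i, (if i = M then c T else if i = T then 0 else c i) • bx n (swapMat n b' M T) i := by
      have e1 : g₁ (φ (bx n a ⟨k, hk⟩)) =
          ∑ i, (c i + if i = M then c T * q else 0) • bx n b' i := by
        rw [hηc, map_sum, sum_single_add]
        simp only [map_zsmul, hg₁, twGen, smul_add, Finset.sum_add_distrib]
        congr 1
        simp [mul_assoc]
      rw [e1, map_sum, ← Equiv.sum_comp (Equiv.swap M T)]
      refine Finset.sum_congr rfl fun i _ => ?_
      rw [map_zsmul, hg₂, Equiv.swap_apply_self]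
      congr 1
      by_cases i1 : i = M
      · subst i1; simp [hMT.ne']
      · by_cases i2 : i = T
        · subst i2; simp [hMT.ne', hcM]
        · rw [Equiv.swap_apply_of_ne_of_ne i1 i2]; simp [i1, i2]
    rw [RingEquiv.trans_apply]
    rw [key, mem_F_iff]
    refine ⟨_, ?_, rfl⟩
    intro i hi
    have i1 : i ≠ M := by rintro rfl; omega
    by_cases i2 : i = T
    · simp [i1, i2, hMT.ne']
    · have n2 : (i : ℕ) ≠ T := fun h => i2 (Fin.ext h)
      simp only [i1, i2, if_false]
      exact hc i (by omega)

end Bott
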